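/- Let δ_BDF2(ζ) = (1-ζ) + (1/2)(1-ζ)². There exists a constant C > 0 such that for all Δt > 0, all r ≥ 0, all t_m with 0 ≤ t_m ≤ r, and all s ∈ ℂ with Re s ≥ 0 and |s| Δt ≤ 1, setting s^{Δt} := δ_BDF2(e^{-s Δt})/Δt, one has |e^{-s r} - e^{-s t_m} e^{-s^{Δt}(r - t_m)}| ≤ C (r - t_m) |s|³ Δt². -/

import Mathlib

/-- The generating function of the BDF2 linear multistep method. -/
noncomputable def deltaBDF2 (ζ : ℂ) : ℂ := (1 - ζ) + (1 / 2) * (1 - ζ) ^ 2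

lemma cq_consist (z : ℂ) (hz : ‖z‖ ≤ 1) :
    ‖deltaBDF2 (Complex.exp (-z)) - z‖ ≤ 3 * ‖z‖ ^ 3 := by
  have hz' : ‖-z‖ ≤ 1 := by simpa using hz
  have h2 := Complex.norm_exp_sub_one_sub_id_le hz'
  have h3 := Complex.exp_bound hz' (n := 3) (by norm_num)
  simp only [Finset.sum_range_succ, Finset.sum_range_zero, norm_neg] at h2 h3
  norm_num [Nat.factorial] at h3
  set E := Complex.exp (-z)
  have e : deltaBDF2 E - z = -(E - (1 + -z + z ^ 2 / 2))
      + (1 / 2) * ((E - 1 - -z) * ((E - 1 - -z) - 2 * z)) := by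
    unfold deltaBDF2; ring
  have hn := norm_nonneg z
  have h4 : ‖(E - 1 - -z) - 2 * z‖ ≤ 3 * ‖z‖ := by
    refine (norm_sub_le _ _).trans ?_
    rw [norm_mul, Complex.norm_ofNat]
    nlinarith
  have h5 : ‖(E - 1 - -z) * ((E - 1 - -z) - 2 * z)‖ ≤ ‖z‖ ^ 2 * (3 * ‖z‖) := by
    rw [norm_mul]; gcongr
  have h6 : ‖(1 / 2 : ℂ) * ((E - 1 - -z) * ((E - 1 - -z) - 2 * z))‖
      ≤ 1 / 2 * (‖z‖ ^ 2 * (3 * ‖z‖)) := by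
    rw [norm_mul]
    have : ‖(1 / 2 : ℂ)‖ = 1 / 2 := by norm_num
    rw [this]; gcongr
  rw [e]
  refine (norm_add_le _ _).trans ?_
  rw [norm_neg]
  have : 0 ≤ ‖z‖ ^ 3 := by positivity
  nlinarith

lemma cq_re_nonneg (ζ : ℂ) (h : ‖ζ‖ ≤ 1) : 0 ≤ (deltaBDF2 ζ).re := by
  have h1 : ζ.re * ζ.re + ζ.im * ζ.im ≤ 1 := by
    rw [← Complex.normSq_apply, Complex.normSq_eq_norm_sq]
    nlinarith [norm_nonneg ζ]
  have h2 : (deltaBDF2 ζ).re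
      = (1 - ζ.re) + 1 / 2 * ((1 - ζ.re) ^ 2 - ζ.im ^ 2) := by
    simp [deltaBDF2, pow_two]
  rw [h2]
  nlinarith [sq_nonneg (1 - ζ.re)]

lemma cq_exp_lip (a b : ℂ) (ha : a.re ≤ 0) (hb : b.re ≤ 0) :
    ‖Complex.exp a - Complex.exp b‖ ≤ ‖a - b‖ := by
  have := (convex_halfSpace_re_le (0 : ℝ)).norm_image_sub_le_of_norm_deriv_le
    (𝕜 := ℂ) (f := Complex.exp) (C := 1) (x := b) (y := a)
    (fun x _ => Complex.differentiable_exp x)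
    (fun x hx => by
      rw [Complex.deriv_exp, Complex.norm_exp]
      exact Real.exp_le_one_iff.2 hx) hb ha
  simpa using this

/-- Error of the modified CQ approximation of the 3D wave
kernel factor: with `s^{Δt} = δ_BDF2(e^{-sΔt})/Δt` and a grid point
`0 ≤ t_m ≤ r` treated exactly,
`|e^{-sr} - e^{-s t_m} e^{-s^{Δt}(r-t_m)}| ≤ C (r-t_m) |s|³ Δt²`. -/
theorem modified_cq_kernel_error :
    ∃ C > (0 : ℝ), ∀ Δt : ℝ, 0 < Δt → ∀ r : ℝ, 0 ≤ r → ∀ tm : ℝ,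
      0 ≤ tm → tm ≤ r → ∀ s : ℂ, 0 ≤ s.re → ‖s‖ * Δt ≤ 1 →
      ‖Complex.exp (-s * r) -
          Complex.exp (-s * tm) *
            Complex.exp (-(deltaBDF2 (Complex.exp (-s * Δt)) / Δt) * (r - tm))‖
        ≤ C * (r - tm) * ‖s‖ ^ 3 * Δt ^ 2 := by
  refine ⟨3, by norm_num, fun Δt hd r hr tm ht htr s hs hsd => ?_⟩
  have hd0 : (Δt : ℂ) ≠ 0 := by exact_mod_cast hd.ne'
  have hn : ‖s * Δt‖ = ‖s‖ * Δt := by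
    rw [norm_mul, Complex.norm_real, Real.norm_of_nonneg hd.le]
  have hc := cq_consist (s * Δt) (by rw [hn]; exact hsd)
  rw [← neg_mul] at hc
  have hre := cq_re_nonneg (Complex.exp (-s * Δt)) (by
    rw [Complex.norm_exp, Real.exp_le_one_iff]
    simp; positivity)
  set D := deltaBDF2 (Complex.exp (-s * Δt))
  have hrt : 0 ≤ r - tm := by linarith
  rw [← Complex.exp_add]
  refine (cq_exp_lip _ _ ?_ ?_).trans ?_
  · simp; positivity
  · have : -s * tm + -(D / Δt) * (r - tm)
        = -(s * (tm : ℝ)) - (D / (Δt : ℝ)) * ((r - tm : ℝ) : ℂ) := by push_cast; ring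
    rw [this, Complex.sub_re, Complex.neg_re, Complex.re_mul_ofReal, Complex.re_mul_ofReal,
      Complex.div_ofReal_re]
    have h1 : 0 ≤ s.re * tm := by positivity
    have h2 : 0 ≤ D.re / Δt * (r - tm) := by positivity
    linarith
  · have : -s * r - (-s * tm + -(D / Δt) * (r - tm))
        = (D - s * Δt) * (((r - tm) / Δt : ℝ) : ℂ) := by
      push_cast; field_simp; ring
    rw [this, norm_mul, Complex.norm_real, Real.norm_of_nonneg (by positivity)]
    calc _ ≤ 3 * ‖s * Δt‖ ^ 3 * ((r - tm) / Δt) := by gcongr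
      _ = _ := by rw [hn]; field_simp
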